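/- arXiv:2403.18382 — 2 statements merged into one kernel-verified Lean document; each statement's English description precedes it below -/
import Mathlib

section
/- Let Φ : ℝ → ℂ be a Schwartz function, let N be a positive integer, let n be an odd positive integer with gcd(n, N) = 1, let r be an integer, let Y > 0, and let n̄ be an integer with n·n̄ ≡ 1 (mod N). Then Σ_{k ∈ ℤ, k ≡ r (mod N)} (k/n)·Φ(k/Y) = (Y/(nN))·(N/n)·Σ_{m ∈ ℤ} Φ̂(mY/(nN))·e(m·r·n̄/N)·τ_m(n), where Φ̂(ξ) = ∫_ℝ Φ(t) e^{−2πiξt} dt, e(x) = exp(2πix), (·/n) is the Jacobi symbol, and τ_m(n) = Σ_{b mod n} (b/n) e(mb/n); both series converge absolutely. -/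
open scoped BigOperators

/-- `e x = exp(2πix)`. -/
noncomputable def e (x : ℝ) : ℂ := Complex.exp (2 * Real.pi * Complex.I * x)

/-- The Gauss sum `τ_m(n) = Σ_{b mod n} (b/n) e(mb/n)`, where `(·/n)` is the Jacobi symbol. -/
noncomputable def tauGauss (m : ℤ) (n : ℕ) : ℂ :=
  ∑ b ∈ Finset.range n, (jacobiSym (b : ℤ) n : ℂ) * e ((m : ℝ) * (b : ℝ) / (n : ℝ))

/-- The Fourier transform `Φ̂(ξ) = ∫ Φ(t) e^{−2πiξt} dt`. -/
noncomputable def fourierT (Φ : ℝ → ℂ) (ξ : ℝ) : ℂ :=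
  ∫ t : ℝ, Φ t * Complex.exp (-(2 * Real.pi * Complex.I * ξ * t))

/-- Absolute summability of a dilated Schwartz function over the integers. -/
lemma SchwartzMap.summable_norm_comp_mul_int (f : SchwartzMap ℝ ℂ) {a : ℝ} (ha : a ≠ 0) :
    Summable fun k : ℤ => ‖f ((k : ℝ) * a)‖ := by
  let g : SchwartzMap ℝ ℂ := SchwartzMap.compCLMOfContinuousLinearEquiv ℂ
    (ContinuousLinearEquiv.unitsEquivAut ℝ (Units.mk0 a ha)) f
  have h : Summable fun k : ℤ => g (k : ℝ) :=
    summable_of_isBigO (Real.summable_abs_int_rpow one_lt_two)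
      ((g.isBigO_cocompact_rpow (-2)).comp_tendsto Int.tendsto_coe_cofinite)
  exact h.norm

lemma norm_e (x : ℝ) : ‖e x‖ = 1 := by
  have h : 2 * (Real.pi : ℂ) * Complex.I * x = ((2 * Real.pi * x : ℝ) : ℂ) * Complex.I := by
    push_cast; ring
  rw [e, h, Complex.norm_exp_ofReal_mul_I]

lemma e_add (x y : ℝ) : e (x + y) = e x * e y := by
  rw [e, e, e, ← Complex.exp_add]
  push_cast
  ring_nf

lemma norm_jacobiSym_le_one (a : ℤ) (n : ℕ) : ‖(jacobiSym a n : ℂ)‖ ≤ 1 := by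
  rcases jacobiSym.trichotomy a n with h | h | h <;> simp [h]

lemma norm_tauGauss_le (m : ℤ) (n : ℕ) : ‖tauGauss m n‖ ≤ n := by
  refine (norm_sum_le_of_le (f := fun b : ℕ => (jacobiSym (b : ℤ) n : ℂ) *
    e ((m : ℝ) * (b : ℝ) / (n : ℝ))) (n := fun _ => 1) (Finset.range n) fun b _ => ?_).trans
    (by simp)
  rw [norm_mul, norm_e, mul_one]
  exact norm_jacobiSym_le_one _ _

lemma fourierT_eq_fourier (f : ℝ → ℂ) : fourierT f = FourierTransform.fourier f := by
  ext ξ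
  rw [Real.fourier_real_eq_integral_exp_smul]
  refine MeasureTheory.integral_congr_ae (.of_forall fun t => ?_)
  simp only [smul_eq_mul]
  rw [mul_comm]
  congr 2
  push_cast
  ring

lemma SchwartzMap.summable_norm_fourierT (f : SchwartzMap ℝ ℂ) {a : ℝ} (ha : a ≠ 0) :
    Summable fun m : ℤ => ‖fourierT f ((m : ℝ) * a)‖ := by
  rw [fourierT_eq_fourier, ← SchwartzMap.fourier_coe]
  exact (FourierTransform.fourier f).summable_norm_comp_mul_int ha

lemma fourierT_comp_mul (f : ℝ → ℂ) {a : ℝ} (ha : 0 < a) (ξ : ℝ) :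
    fourierT (fun t => f (t * a)) ξ = (a⁻¹ : ℝ) * fourierT f (ξ / a) := by
  have h := MeasureTheory.Measure.integral_comp_mul_right
    (fun t : ℝ => f t * Complex.exp (-(2 * Real.pi * Complex.I * (ξ / a : ℝ) * t))) a
  rw [abs_of_pos (inv_pos.mpr ha), Complex.real_smul] at h
  rw [fourierT, fourierT, ← h]
  refine MeasureTheory.integral_congr_ae (.of_forall fun t => ?_)
  have ha' : (a : ℂ) ≠ 0 := mod_cast ha.ne'
  dsimp only
  congr 3
  push_cast
  field_simp

/-- **Poisson summation** for a dilated and translated Schwartz function. -/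
lemma SchwartzMap.tsum_comp_mul_eq (f : SchwartzMap ℝ ℂ) {a : ℝ} (ha : 0 < a) (x : ℝ) :
    ∑' j : ℤ, f ((x + j) * a) =
      (a⁻¹ : ℝ) * ∑' m : ℤ, fourierT f ((m : ℝ) / a) * e ((m : ℝ) * x) := by
  let g : SchwartzMap ℝ ℂ := SchwartzMap.compCLMOfContinuousLinearEquiv ℂ
    (ContinuousLinearEquiv.unitsEquivAut ℝ (Units.mk0 a ha.ne')) f
  have hg : (g : ℝ → ℂ) = fun t => f (t * a) := rfl
  have h := g.tsum_eq_tsum_fourier x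
  rw [SchwartzMap.fourier_coe, ← fourierT_eq_fourier, hg] at h
  rw [h, ← tsum_mul_left]
  refine tsum_congr fun m => ?_
  rw [fourierT_comp_mul _ ha, mul_assoc, fourier_coe_apply, e]
  congr 3
  push_cast
  ring

lemma tsum_int_eq_sum_range_tsum {F : ℤ → ℂ} (hF : Summable F) (n : ℕ) (hn : 0 < n) :
    ∑' k, F k = ∑ b ∈ Finset.range n, ∑' j : ℤ, F (j * n + b) := by
  have : NeZero n := ⟨hn.ne'⟩
  let σ : Fin n × ℤ ≃ ℤ := (Equiv.prodComm _ _).trans (Int.divModEquiv n).symm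
  have hσ : Summable fun p => F (σ p) := σ.summable_iff.mpr hF
  rw [← σ.tsum_eq, hσ.tsum_prod, tsum_fintype, Finset.sum_range]
  rfl

lemma injective_add_natCast_mul {N : ℕ} (hN : 0 < N) (c : ℤ) :
    Function.Injective fun l : ℤ => c + N * l := fun x y hxy => by
  simpa [hN.ne'] using hxy

lemma tsum_ite_modEq {F : ℤ → ℂ} {N : ℕ} (hN : 0 < N) {r c : ℤ} (hc : c ≡ r [ZMOD N])
    [DecidablePred fun k : ℤ => k ≡ r [ZMOD N]] :
    ∑' k : ℤ, (if k ≡ r [ZMOD N] then F k else 0) = ∑' l : ℤ, F (c + N * l) := by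
  rw [← (injective_add_natCast_mul hN c).tsum_eq]
  · refine tsum_congr fun l => if_pos ?_
    exact (Int.modEq_iff_dvd.mpr ⟨-l, by ring⟩ : c + N * l ≡ c [ZMOD N]).trans hc
  · intro k hk
    have hk' : k ≡ r [ZMOD N] := by
      by_contra h
      simp [h] at hk
    obtain ⟨l, hl⟩ := (hc.trans hk'.symm).dvd
    exact ⟨l, by simp only; lia⟩

open scoped Classical in
/-- Poisson summation for `Σ_{k ≡ r (mod N)} (k/n) Φ(k/Y)` with a Schwartz function `Φ`. -/
theorem poisson_jacobi (Φ : SchwartzMap ℝ ℂ) (N : ℕ) (hN : 0 < N) (n : ℕ) (hn : 0 < n)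
    (hnodd : Odd n) (hcop : Nat.Coprime n N) (r : ℤ) (Y : ℝ) (hY : 0 < Y)
    (nbar : ℤ) (hnbar : (n : ℤ) * nbar ≡ 1 [ZMOD (N : ℤ)]) :
    Summable (fun k : ℤ =>
      ‖if k ≡ r [ZMOD (N : ℤ)] then (jacobiSym k n : ℂ) * Φ ((k : ℝ) / Y) else 0‖) ∧
    Summable (fun m : ℤ =>
      ‖fourierT (fun t => Φ t) ((m : ℝ) * Y / ((n : ℝ) * (N : ℝ))) *
          e ((m : ℝ) * (r : ℝ) * (nbar : ℝ) / (N : ℝ)) * tauGauss m n‖) ∧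
    (∑' k : ℤ, if k ≡ r [ZMOD (N : ℤ)] then (jacobiSym k n : ℂ) * Φ ((k : ℝ) / Y) else 0) =
      (Y / ((n : ℝ) * (N : ℝ)) : ℝ) * (jacobiSym (N : ℤ) n : ℂ) *
        ∑' m : ℤ, fourierT (fun t => Φ t) ((m : ℝ) * Y / ((n : ℝ) * (N : ℝ))) *
          e ((m : ℝ) * (r : ℝ) * (nbar : ℝ) / (N : ℝ)) * tauGauss m n := by
  have hn' : (n : ℝ) ≠ 0 := by positivity
  have hN' : (N : ℝ) ≠ 0 := by positivity
  have ha : 0 < (n : ℝ) * N / Y := by positivity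
  have hsum : Summable fun k : ℤ => ‖(jacobiSym k n : ℂ) * Φ ((k : ℝ) / Y)‖ := by
    refine .of_nonneg_of_le (fun _ => norm_nonneg _) (fun k => ?_)
      (Φ.summable_norm_comp_mul_int (inv_ne_zero hY.ne'))
    rw [norm_mul, div_eq_mul_inv]
    exact mul_le_of_le_one_left (norm_nonneg _) (norm_jacobiSym_le_one _ _)
  have hfour : Summable fun m : ℤ =>
      ‖fourierT (fun t => Φ t) ((m : ℝ) * Y / ((n : ℝ) * (N : ℝ)))‖ := by
    refine (Φ.summable_norm_fourierT (a := Y / ((n : ℝ) * N)) (by positivity)).congr fun m => ?_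
    rw [mul_div_assoc]
  refine ⟨.of_nonneg_of_le (fun _ => norm_nonneg _) (fun k => ?_) hsum,
    .of_nonneg_of_le (fun _ => norm_nonneg _) (fun m => ?_) (hfour.mul_right (n : ℝ)), ?_⟩
  · split_ifs
    · exact le_rfl
    · rw [norm_zero]
      exact norm_nonneg _
  · rw [norm_mul, norm_mul, norm_e, mul_one]
    exact mul_le_mul_of_nonneg_left (norm_tauGauss_le m n) (norm_nonneg _)
  have hc : r * (n * nbar) ≡ r [ZMOD N] := by simpa using hnbar.mul_left r
  have hinj := injective_add_natCast_mul hN (r * (n * nbar))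
  have hjac (j : ℤ) (b : ℕ) : jacobiSym (r * (n * nbar) + N * (j * n + b)) n =
      jacobiSym N n * jacobiSym b n := by
    rw [← jacobiSym.mul_left]
    refine jacobiSym.mod_left' (Int.modEq_iff_dvd.mpr ⟨-(r * nbar + N * j), by ring⟩)
  have hpoisson (b : ℕ) : ∑' j : ℤ, (jacobiSym (r * (n * nbar) + N * (j * n + b)) n : ℂ) *
        Φ (((r * (n * nbar) + N * (j * n + b) : ℤ) : ℝ) / Y) =
      ∑' m : ℤ, (Y / ((n : ℝ) * (N : ℝ)) : ℝ) * (jacobiSym (N : ℤ) n : ℂ) *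
        (fourierT (fun t => Φ t) ((m : ℝ) * Y / ((n : ℝ) * (N : ℝ))) *
          e ((m : ℝ) * (r : ℝ) * (nbar : ℝ) / (N : ℝ)) *
          ((jacobiSym (b : ℤ) n : ℂ) * e ((m : ℝ) * (b : ℝ) / (n : ℝ)))) := by
    have h := Φ.tsum_comp_mul_eq ha ((r : ℝ) * nbar / N + b / n)
    calc
      _ = (jacobiSym N n * jacobiSym b n : ℂ) *
          ∑' j : ℤ, Φ (((r : ℝ) * nbar / N + b / n + j) * ((n : ℝ) * N / Y)) := by
        rw [← tsum_mul_left]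
        refine tsum_congr fun j => ?_
        rw [hjac]
        push_cast
        congr 2
        field_simp
        ring
      _ = _ := by
        rw [h, ← tsum_mul_left, ← tsum_mul_left]
        refine tsum_congr fun m => ?_
        have h₁ : (m : ℝ) * ((r : ℝ) * nbar / N + b / n) =
            (m : ℝ) * r * nbar / N + (m : ℝ) * b / n := by ring
        rw [h₁, e_add, inv_div, div_div_eq_mul_div]
        ring
  rw [tsum_ite_modEq hN hc]
  refine (tsum_int_eq_sum_range_tsum (hsum.of_norm.comp_injective hinj) n hn).trans ?_
  simp only [Function.comp_apply]
  rw [Finset.sum_congr rfl fun b _ => hpoisson b, ← tsum_mul_left, ← Summable.tsum_finsetSum]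
  · refine tsum_congr fun m => ?_
    rw [tauGauss, Finset.mul_sum, Finset.mul_sum]
  · intro b _
    refine .mul_left _ (.of_norm_bounded hfour fun m => ?_)
    rw [norm_mul, norm_mul, norm_mul, norm_e, norm_e, mul_one, mul_one]
    exact mul_le_of_le_one_right (norm_nonneg _) (norm_jacobiSym_le_one _ _)
end

section
/- For every prime p and every integer α ≥ 2, one has |G(p^α)| ≤ 2·(log c(p))^α / p. -/
open scoped BigOperators

/-- `c(p) = 1 + #{z mod p : F(z) ≡ 0 (mod p)}`. -/
def cF (F : Polynomial ℤ) (p : ℕ) : ℕ :=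
  1 + ((Finset.range p).filter (fun z : ℕ => (p : ℤ) ∣ F.eval (z : ℤ))).card

/-- `C_p(s) = (p/(p+1))·log c(p)` if `p ∣ s`, and `−(1/(p+1))·log c(p)` otherwise. -/
noncomputable def CpF (F : Polynomial ℤ) (p s : ℕ) : ℝ :=
  if p ∣ s then ((p : ℝ) / ((p : ℝ) + 1)) * Real.log (cF F p)
  else -(1 / ((p : ℝ) + 1)) * Real.log (cF F p)

/-- For `n = q_1^{m_1} ⋯ q_u^{m_u}`,
`G(n) = Σ_{v ∣ q_1⋯q_u} Σ_{rs = v} μ(r) (Π_i C_{q_i}(s)^{m_i}) Π_{p ∣ v} 1/(p+1)`. -/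
noncomputable def GF (F : Polynomial ℤ) (n : ℕ) : ℝ :=
  ∑ v ∈ (∏ p ∈ n.primeFactors, p).divisors, ∑ r ∈ v.divisors,
    (ArithmeticFunction.moebius r : ℝ) *
      (∏ p ∈ n.primeFactors, (CpF F p (v / r)) ^ (n.factorization p)) *
      ∏ p ∈ v.primeFactors, (1 : ℝ) / ((p : ℝ) + 1)

/-- At a prime power, `G` has the three terms `(v, r) = (1, 1), (p, 1), (p, p)`. -/
theorem GF_prime_pow (F : Polynomial ℤ) {p : ℕ} (hp : p.Prime) {α : ℕ} (hα : α ≠ 0) :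
    GF F (p ^ α) = Real.log (cF F p) ^ α *
      ((-(1 / ((p : ℝ) + 1))) ^ α * (p / (p + 1)) + (p / (p + 1)) ^ α * (1 / (p + 1))) := by
  have hp1 : (p : ℝ) + 1 ≠ 0 := by positivity
  have hC1 : CpF F p 1 = -(1 / ((p : ℝ) + 1)) * Real.log (cF F p) :=
    if_neg hp.not_dvd_one
  have hCp : CpF F p p = (p : ℝ) / (p + 1) * Real.log (cF F p) := if_pos dvd_rfl
  have hfac : (p ^ α).factorization p = α := by simp [hp.factorization]
  have hGF : GF F (p ^ α) = CpF F p 1 ^ α +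
      (CpF F p p ^ α * (1 / (p + 1)) - CpF F p 1 ^ α * (1 / (p + 1))) := by
    unfold GF
    rw [Nat.primeFactors_prime_pow hα hp]
    simp only [Finset.prod_singleton, hfac]
    rw [hp.sum_divisors, Nat.divisors_one, Finset.sum_singleton, hp.sum_divisors,
      hp.primeFactors, Nat.div_self hp.pos, ArithmeticFunction.moebius_apply_prime hp]
    simp
    ring
  rw [hGF, hC1, hCp, mul_pow, mul_pow]
  have hb : (p : ℝ) / (p + 1) = 1 - 1 / (p + 1) := by field_simp; ring
  rw [hb]
  ring

/-- For every prime `p` and `α ≥ 2`, `|G(p^α)| ≤ 2(log c(p))^α / p`. -/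
theorem GF_prime_pow_bound (F : Polynomial ℤ) (hF : F.Monic) (hdeg : F.natDegree = 3)
    (p : ℕ) (hp : p.Prime) (α : ℕ) (hα : 2 ≤ α) :
    |GF F (p ^ α)| ≤ 2 * (Real.log (cF F p)) ^ α / (p : ℝ) := by
  have hp0 : (0 : ℝ) < p := by exact_mod_cast hp.pos
  have hα0 : α ≠ 0 := by omega
  have hL : 0 ≤ Real.log (cF F p) := Real.log_natCast_nonneg _
  have ha : 0 ≤ 1 / ((p : ℝ) + 1) := by positivity
  have ha1 : 1 / ((p : ℝ) + 1) ≤ 1 := by rw [div_le_one (by positivity)]; linarith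
  have hb : 0 ≤ (p : ℝ) / (p + 1) := by positivity
  have hb1 : (p : ℝ) / (p + 1) ≤ 1 := by rw [div_le_one (by positivity)]; linarith
  have hap : 1 / ((p : ℝ) + 1) ≤ 1 / p := one_div_le_one_div_of_le hp0 (by linarith)
  rw [GF_prime_pow F hp hα0, abs_mul, abs_of_nonneg (pow_nonneg hL α), mul_comm 2, mul_div_assoc]
  refine mul_le_mul_of_nonneg_left ?_ (pow_nonneg hL α)
  generalize 1 / ((p : ℝ) + 1) = a at *
  generalize (p : ℝ) / (p + 1) = b at *
  calc |(-a) ^ α * b + b ^ α * a| ≤ |(-a) ^ α * b| + |b ^ α * a| := abs_add_le _ _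
    _ = a ^ α * b + b ^ α * a := by
      rw [abs_mul, abs_mul, abs_pow, abs_pow, abs_neg, abs_of_nonneg ha, abs_of_nonneg hb]
    _ ≤ a * 1 + 1 * a := by
      gcongr
      · exact pow_le_of_le_one ha ha1 hα0
      · exact pow_le_one₀ hb hb1
    _ ≤ 2 / p := by linarith [show (2 : ℝ) / p = 2 * (1 / p) by ring]
end
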